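/- Let d ≥ 1, k ≥ d+1, p ≥ 1, h = k−d−1, and let Q ∈ M_{kp}(ℝ) be invertible. Define P := [I_p, 0]·Q (first p rows), R := [0, I_{dp}, 0]·Q (rows p+1,…,(d+1)p), ℍ := [0, I_{hp}]·Q (last hp rows), Q̄ := [I_{(d+1)p}, 0]·Q, and Q̄⁺ := Q⁻¹·[I_{(d+1)p}; 0]. Let Λ₁,…,Λ_d ∈ M_{kp}(ℝ) be diagonal matrices such that the i-th block of p rows of R equals P·Λ_i for every i. Let C := blockdiag(α·I_p, C̃, α·I_{hp}) with α ∈ ℝ and C̃ ∈ M_{dp}(ℝ), and Ω := Q⁻¹·C·Q. Let 𝕄 : ℝ^p → ℝ^{kp} satisfy P·𝕄(w) = w, (P·Λ_i)·𝕄(w) = f_i(w) for given maps f_i : ℝ^p → ℝ^p, and ℍ·𝕄(w) = 0 for all w. Let c > 0 and let F : ℝ × ℝ^d → ℝ^{kp} be continuously differentiable, satisfy ℍ·F(t,x) = 0 for all (t,x), and satisfy the kinetic system ∂F/∂t + Σ_{i=1}^d Λ_i·∂F/∂x_i = c·Ω·(𝕄(P·F) − F). Then the vector U := Q̄·F = (u,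 v_1, …, v_d), with u := P·F and v_i := P·Λ_i·F, satisfies the Jin–Xin system ∂U/∂t + Σ_{i=1}^d A_i·∂U/∂x_i = B, where A_i := Q̄·Λ_i·Q̄⁺ and B has first block component 0 ∈ ℝ^p and remaining components c·C̃·(f_1(u) − v_1, …, f_d(u) − v_d). -/

import Mathlib

open Matrix

/-- A matrix acting on a differentiable vector field commutes with differentiation. -/
theorem fderiv_matrix_mulVec {E m n : Type*} [NormedAddCommGroup E] [NormedSpace ℝ E]
    [Fintype m] [Fintype n] (M : Matrix m n ℝ) {F : E → n → ℝ} {q : E}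
    (hF : DifferentiableAt ℝ F q) (v : E) :
    fderiv ℝ (fun q => M *ᵥ F q) q v = M *ᵥ fderiv ℝ F q v := by
  have h := (LinearMap.toContinuousLinearMap M.mulVecLin).hasFDerivAt.comp q hF.hasFDerivAt
  exact DFunLike.congr_fun h.fderiv v

/-- If `w` vanishes outside the range of an injective map `e`, then `N *ᵥ w` only involves the
columns of `N` and the entries of `w` indexed by that range. -/
theorem submatrix_mulVec_comp {m n l : Type*} [Fintype n] [Fintype l]
    (N : Matrix m n ℝ) {e : l → n} (he : Function.Injective e) (w : n → ℝ)
    (hw : ∀ j, j ∉ Set.range e → w j = 0) :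
    N.submatrix id e *ᵥ (w ∘ e) = N *ᵥ w := by
  ext i
  exact Fintype.sum_of_injective e he _ _ (fun j hj => by simp [hw j hj]) fun _ => rfl

/-- Proposition 4.2 (forward direction): a regularized collision matrix
kinetic model is equivalent to a Jin–Xin relaxation system on the variables
`U = Q̄·F = (u, v₁, …, v_d)`. The full index type is
`Fin p ⊕ ((Fin d × Fin p) ⊕ (Fin h × Fin p))`, the reduced one
`Fin p ⊕ (Fin d × Fin p)`. -/
theorem stmt_15 (d k h p : ℕ) (hd : 1 ≤ d) (hk : d + 1 ≤ k) (hp : 1 ≤ p)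
    (hh : h = k - d - 1)
    (Q : Matrix (Fin p ⊕ ((Fin d × Fin p) ⊕ (Fin h × Fin p)))
      (Fin p ⊕ ((Fin d × Fin p) ⊕ (Fin h × Fin p))) ℝ)
    (hQ : IsUnit Q.det)
    (P : Matrix (Fin p) (Fin p ⊕ ((Fin d × Fin p) ⊕ (Fin h × Fin p))) ℝ)
    (hP : ∀ i j, P i j = Q (Sum.inl i) j)
    (R : Matrix (Fin d × Fin p) (Fin p ⊕ ((Fin d × Fin p) ⊕ (Fin h × Fin p))) ℝ)
    (hR : ∀ i j, R i j = Q (Sum.inr (Sum.inl i)) j)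
    (H : Matrix (Fin h × Fin p) (Fin p ⊕ ((Fin d × Fin p) ⊕ (Fin h × Fin p))) ℝ)
    (hH : ∀ i j, H i j = Q (Sum.inr (Sum.inr i)) j)
    (Qbar : Matrix (Fin p ⊕ (Fin d × Fin p))
      (Fin p ⊕ ((Fin d × Fin p) ⊕ (Fin h × Fin p))) ℝ)
    (hQbar : ∀ i j, Qbar i j = Q (Sum.map id Sum.inl i) j)
    (Qplus : Matrix (Fin p ⊕ ((Fin d × Fin p) ⊕ (Fin h × Fin p)))
      (Fin p ⊕ (Fin d × Fin p)) ℝ)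
    (hQplus : ∀ i j, Qplus i j = Q⁻¹ i (Sum.map id Sum.inl j))
    (Λ : Fin d → Matrix (Fin p ⊕ ((Fin d × Fin p) ⊕ (Fin h × Fin p)))
      (Fin p ⊕ ((Fin d × Fin p) ⊕ (Fin h × Fin p))) ℝ)
    (hΛdiag : ∀ i, (Λ i).IsDiag)
    (hRP : ∀ (i : Fin d) (r : Fin p) (c : Fin p ⊕ ((Fin d × Fin p) ⊕ (Fin h × Fin p))),
      R (i, r) c = (P * Λ i) r c)
    (α : ℝ) (Ctilde : Matrix (Fin d × Fin p) (Fin d × Fin p) ℝ)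
    (C : Matrix (Fin p ⊕ ((Fin d × Fin p) ⊕ (Fin h × Fin p)))
      (Fin p ⊕ ((Fin d × Fin p) ⊕ (Fin h × Fin p))) ℝ)
    (hC : C = Matrix.fromBlocks (α • (1 : Matrix (Fin p) (Fin p) ℝ)) 0 0
      (Matrix.fromBlocks Ctilde 0 0
        (α • (1 : Matrix (Fin h × Fin p) (Fin h × Fin p) ℝ))))
    (Ω : Matrix (Fin p ⊕ ((Fin d × Fin p) ⊕ (Fin h × Fin p)))
      (Fin p ⊕ ((Fin d × Fin p) ⊕ (Fin h × Fin p))) ℝ)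
    (hΩ : Ω = Q⁻¹ * C * Q)
    (f : Fin d → (Fin p → ℝ) → (Fin p → ℝ))
    (𝕄 : (Fin p → ℝ) → (Fin p ⊕ ((Fin d × Fin p) ⊕ (Fin h × Fin p)) → ℝ))
    (h𝕄0 : ∀ w, P.mulVec (𝕄 w) = w)
    (h𝕄1 : ∀ (i : Fin d) (w : Fin p → ℝ), (P * Λ i).mulVec (𝕄 w) = f i w)
    (h𝕄H : ∀ w, H.mulVec (𝕄 w) = 0)
    (c : ℝ) (hc : 0 < c)
    (F : ℝ × (Fin d → ℝ) → (Fin p ⊕ ((Fin d × Fin p) ⊕ (Fin h × Fin p)) → ℝ))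
    (hF : ContDiff ℝ 1 F)
    (hreg : ∀ (t : ℝ) (x : Fin d → ℝ), H.mulVec (F (t, x)) = 0)
    (hkin : ∀ (t : ℝ) (x : Fin d → ℝ),
      fderiv ℝ F (t, x) (1, 0)
        + ∑ i, (Λ i).mulVec (fderiv ℝ F (t, x) (0, Pi.single i 1))
      = c • Ω.mulVec (𝕄 (P.mulVec (F (t, x))) - F (t, x)))
    (U : ℝ × (Fin d → ℝ) → (Fin p ⊕ (Fin d × Fin p) → ℝ))
    (hU : ∀ q, U q = Qbar.mulVec (F q))
    (A : Fin d → Matrix (Fin p ⊕ (Fin d × Fin p)) (Fin p ⊕ (Fin d × Fin p)) ℝ)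
    (hA : ∀ i, A i = Qbar * Λ i * Qplus) :
    ∀ (t : ℝ) (x : Fin d → ℝ),
      fderiv ℝ U (t, x) (1, 0)
        + ∑ i, (A i).mulVec (fderiv ℝ U (t, x) (0, Pi.single i 1))
      = Sum.elim (0 : Fin p → ℝ)
          (c • Ctilde.mulVec (fun z =>
            f z.1 (P.mulVec (F (t, x))) z.2
              - (P * Λ z.1).mulVec (F (t, x)) z.2)) := by
  intro t x
  have hQmul (v) : Q *ᵥ v = Sum.elim (P *ᵥ v) (Sum.elim (R *ᵥ v) (H *ᵥ v)) := by
    ext (i | i | i) <;> simp [mulVec, dotProduct, hP, hR, hH]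
  have hQbarmul (v) : Qbar *ᵥ v = (Q *ᵥ v) ∘ Sum.map id Sum.inl := by
    ext i
    simp [mulVec, dotProduct, hQbar]
  have hQplus_eq : Qplus = Q⁻¹.submatrix id (Sum.map id Sum.inl) := by
    ext i j
    exact hQplus i j
  have hreconstruct (v) (hv : H *ᵥ v = 0) : Qplus *ᵥ (Qbar *ᵥ v) = v := by
    rw [hQbarmul, hQplus_eq, submatrix_mulVec_comp _
      (Function.injective_id.sumMap Sum.inl_injective), mulVec_mulVec, nonsing_inv_mul _ hQ,
      one_mulVec]
    rintro (j | j | j) hj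
    · exact absurd ⟨Sum.inl j, rfl⟩ hj
    · exact absurd ⟨Sum.inr j, rfl⟩ hj
    · simp [hQmul, hv]
  have hdF : DifferentiableAt ℝ F (t, x) := hF.differentiable one_ne_zero _
  have hdU (v) : fderiv ℝ U (t, x) v = Qbar *ᵥ fderiv ℝ F (t, x) v := by
    rw [funext hU, fderiv_matrix_mulVec _ hdF]
  have hdH (v) : H *ᵥ fderiv ℝ F (t, x) v = 0 := by
    have hzero : (fun q => H *ᵥ F q) = fun _ => 0 := funext fun q => hreg q.1 q.2
    rw [← fderiv_matrix_mulVec _ hdF, hzero]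
    simp
  have hflux (i) (v) : A i *ᵥ fderiv ℝ U (t, x) v = Qbar *ᵥ (Λ i *ᵥ fderiv ℝ F (t, x) v) := by
    rw [hdU, hA, ← mulVec_mulVec, hreconstruct _ (hdH v), mulVec_mulVec]
  have hRmul (v) : R *ᵥ v = fun z => ((P * Λ z.1) *ᵥ v) z.2 := by
    ext z
    simp only [mulVec, dotProduct, hRP z.1 z.2]
  simp only [hflux]
  rw [hdU, ← mulVec_sum, ← mulVec_add, hkin, mulVec_smul, hQbarmul, hΩ, mulVec_mulVec,
    Matrix.mul_assoc, mul_nonsing_inv_cancel_left _ _ hQ, ← mulVec_mulVec, hQmul, hC,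
    fromBlocks_mulVec, mulVec_sub P, h𝕄0, sub_self, hRmul]
  ext (i | i)
  · simp
  · simp [fromBlocks_mulVec, mulVec_sub, h𝕄1, Function.comp_def]
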